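/- (Identifiability of Gaussian mixture parameters up to permutation.) Let μ = ∑_{k ∈ Fin K} π_k • gaussianReal(m_k, v_k) and μ' = ∑_{k ∈ Fin K'} π'_k • gaussianReal(m'_k, v'_k) be two finite Gaussian mixtures on ℝ with all weights strictly positive (π_k > 0, π'_k > 0), weights summing to 1, all variances strictly positive, and such that within each mixture the parameter pairs are pairwise distinct: (m_k, v_k) ≠ (m_l, v_l) for k ≠ l and (m'_k, v'_k) ≠ (m'_l, v'_l) for k ≠ l. If μ = μ' as measures on ℝ, then there exists a bijection τ : Fin K ≃ Fin K' such that π_k = π'_{τ(k)}, m_k = m'_{τ(k)}, and v_k = v'_{τ(k)} for all k (in particular K = K'). -/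

import Mathlib

open MeasureTheory ProbabilityTheory
open scoped NNReal

lemma gm_decay (a b : ℝ) (h : b < 0 ∨ (b = 0 ∧ a < 0)) :
    Filter.Tendsto (fun t : ℝ => Real.exp (a * t + b * t ^ 2 / 2)) Filter.atTop (nhds 0) := by
  apply Real.tendsto_exp_atBot.comp
  rcases h with hb | ⟨rfl, ha⟩
  · have h1 : Filter.Tendsto (fun t : ℝ => a + b / 2 * t) Filter.atTop Filter.atBot :=
      Filter.tendsto_atBot_add_const_left _ _
        (Filter.tendsto_id.const_mul_atTop_of_neg (by linarith))
    refine (Filter.tendsto_id.atTop_mul_atBot₀ h1).congr ?_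
    intro t
    simp only [id]
    ring
  · refine (Filter.tendsto_id.const_mul_atTop_of_neg ha).congr ?_
    intro t
    simp

lemma gm_indep (S : Finset (ℝ × ℝ≥0)) (c : ℝ × ℝ≥0 → ℝ)
    (h : ∀ t : ℝ, ∑ p ∈ S, c p * Real.exp (p.1 * t + p.2 * t ^ 2 / 2) = 0) :
    ∀ p ∈ S, c p = 0 := by
  classical
  by_contra! hne
  obtain ⟨p0, hp0, hc0⟩ := hne
  obtain ⟨q, hq, hmax⟩ := (S.filter (fun p => c p ≠ 0)).exists_max_image
    (fun p => toLex (p.2, p.1)) ⟨p0, by simp [hp0, hc0]⟩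
  rw [Finset.mem_filter] at hq
  have hlim : Filter.Tendsto (fun t : ℝ => ∑ p ∈ S, c p *
      Real.exp ((p.1 - q.1) * t + ((p.2 : ℝ) - q.2) * t ^ 2 / 2)) Filter.atTop
      (nhds (∑ p ∈ S, if p = q then c q else 0)) := by
    apply tendsto_finsetSum
    intro p hp
    by_cases hpq : p = q
    · subst hpq
      simp
    rw [if_neg hpq]
    by_cases hcp : c p = 0
    · simp [hcp]
    have hle := hmax p (by simp [hp, hcp])
    rw [Prod.Lex.toLex_le_toLex] at hle
    have := (gm_decay (p.1 - q.1) ((p.2 : ℝ) - q.2) ?_).const_mul (c p)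
    · simpa using this
    rcases hle with hlt | ⟨he, hle⟩
    · left
      have : (p.2 : ℝ) < q.2 := by exact_mod_cast hlt
      linarith
    · right
      simp only at he hle
      refine ⟨by rw [he]; ring, ?_⟩
      have : p.1 ≠ q.1 := fun h' => hpq (Prod.ext h' he)
      have := lt_of_le_of_ne hle this
      linarith
  have hz : ∀ t : ℝ, ∑ p ∈ S, c p *
      Real.exp ((p.1 - q.1) * t + ((p.2 : ℝ) - q.2) * t ^ 2 / 2) = 0 := by
    intro t
    have := congrArg (· * Real.exp (-(q.1 * t + q.2 * t ^ 2 / 2))) (h t)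
    simp only [zero_mul, Finset.sum_mul] at this
    rw [← this]
    refine Finset.sum_congr rfl fun p _ => ?_
    rw [mul_assoc, ← Real.exp_add]
    congr 2
    ring
  simp only [hz] at hlim
  have := tendsto_nhds_unique hlim tendsto_const_nhds
  simp [hq.1, hq.2] at this

lemma gm_mgf {K : ℕ} (w : Fin K → ℝ≥0) (m : Fin K → ℝ) (v : Fin K → ℝ≥0) (t : ℝ) :
    ∫ x, Real.exp (t * x) ∂(∑ k, (w k) • gaussianReal (m k) (v k))
      = ∑ k, (w k : ℝ) * Real.exp (m k * t + v k * t ^ 2 / 2) := by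
  rw [integral_finsetSum_measure]
  · refine Finset.sum_congr rfl fun k _ => ?_
    rw [integral_smul_nnreal_measure, NNReal.smul_def, smul_eq_mul]
    congr 1
    exact congrFun (mgf_id_gaussianReal (μ := m k) (v := v k)) t
  · intro k _
    exact (integrable_exp_mul_gaussianReal t).smul_measure_nnreal

open Classical in
/-- total weight attached to a parameter pair -/
noncomputable def gmW {K : ℕ} (w : Fin K → ℝ≥0) (m : Fin K → ℝ) (v : Fin K → ℝ≥0)
    (p : ℝ × ℝ≥0) : ℝ := ∑ k, if (m k, v k) = p then (w k : ℝ) else 0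

open Classical in
lemma gmW_sum {K : ℕ} (w : Fin K → ℝ≥0) (m : Fin K → ℝ) (v : Fin K → ℝ≥0)
    (S : Finset (ℝ × ℝ≥0)) (hS : ∀ k, (m k, v k) ∈ S) (f : ℝ × ℝ≥0 → ℝ) :
    ∑ p ∈ S, gmW w m v p * f p = ∑ k, (w k : ℝ) * f (m k, v k) := by
  simp only [gmW, Finset.sum_mul]
  rw [Finset.sum_comm]
  refine Finset.sum_congr rfl fun k _ => ?_
  simp [ite_mul, hS k]

lemma gmW_self {K : ℕ} (w : Fin K → ℝ≥0) (m : Fin K → ℝ) (v : Fin K → ℝ≥0)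
    (hdist : ∀ k l, k ≠ l → (m k, v k) ≠ (m l, v l)) (k : Fin K) :
    gmW w m v (m k, v k) = w k := by
  classical
  unfold gmW
  rw [Finset.sum_eq_single k]
  · simp
  · intro l _ hl
    rw [if_neg (hdist l k hl)]
  · simp

lemma gmW_exists {K : ℕ} (w : Fin K → ℝ≥0) (m : Fin K → ℝ) (v : Fin K → ℝ≥0)
    (p : ℝ × ℝ≥0) (h : gmW w m v p ≠ 0) : ∃ k, (m k, v k) = p := by
  by_contra! hne
  apply h
  unfold gmW
  exact Finset.sum_eq_zero fun k _ => if_neg (hne k)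

/-- Identifiability of finite Gaussian mixture parameters on `ℝ` up to permutation:
two equal mixtures with strictly positive weights summing to one, strictly positive
variances, and pairwise distinct component parameters, have the same parameters up to a
bijection of component indices. -/
theorem gaussianMixture_param_identifiability {K K' : ℕ}
    (π : Fin K → ℝ≥0) (hπpos : ∀ k, 0 < π k) (hπ : ∑ k, π k = 1)
    (m : Fin K → ℝ) (v : Fin K → ℝ≥0) (hv : ∀ k, 0 < v k)
    (hdist : ∀ k l, k ≠ l → (m k, v k) ≠ (m l, v l))
    (π' : Fin K' → ℝ≥0) (hπ'pos : ∀ k, 0 < π' k) (hπ' : ∑ k, π' k = 1)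
    (m' : Fin K' → ℝ) (v' : Fin K' → ℝ≥0) (hv' : ∀ k, 0 < v' k)
    (hdist' : ∀ k l, k ≠ l → (m' k, v' k) ≠ (m' l, v' l))
    (heq : (∑ k, (π k) • gaussianReal (m k) (v k))
      = ∑ k, (π' k) • gaussianReal (m' k) (v' k)) :
    ∃ τ : Fin K ≃ Fin K',
      ∀ k, π k = π' (τ k) ∧ m k = m' (τ k) ∧ v k = v' (τ k) := by
  classical
  have hinj : ∀ k l, (m k, v k) = (m l, v l) → k = l := fun k l h => by
    by_contra hn
    exact hdist k l hn h
  have hinj' : ∀ k l, (m' k, v' k) = (m' l, v' l) → k = l := fun k l h => by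
    by_contra hn
    exact hdist' k l hn h
  let S : Finset (ℝ × ℝ≥0) := Finset.univ.image (fun k => (m k, v k)) ∪
    Finset.univ.image (fun k => (m' k, v' k))
  have hS : ∀ k, (m k, v k) ∈ S := fun k => Finset.mem_union_left _
    (Finset.mem_image_of_mem (fun k => (m k, v k)) (Finset.mem_univ k))
  have hS' : ∀ k, (m' k, v' k) ∈ S := fun k => Finset.mem_union_right _
    (Finset.mem_image_of_mem (fun k => (m' k, v' k)) (Finset.mem_univ k))
  have key : ∀ p ∈ S, gmW π m v p = gmW π' m' v' p := by
    intro p hp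
    refine sub_eq_zero.1 (gm_indep S (fun p => gmW π m v p - gmW π' m' v' p) ?_ p hp)
    intro t
    simp only [sub_mul, Finset.sum_sub_distrib]
    rw [gmW_sum π m v S hS (fun p => Real.exp (p.1 * t + p.2 * t ^ 2 / 2)),
      gmW_sum π' m' v' S hS' (fun p => Real.exp (p.1 * t + p.2 * t ^ 2 / 2)),
      ← gm_mgf, ← gm_mgf, heq, sub_self]
  have h1 : ∀ k, ∃ l, (m' l, v' l) = (m k, v k) := by
    intro k
    apply gmW_exists π'
    rw [← key _ (hS k), gmW_self π m v hdist]
    exact_mod_cast (hπpos k).ne'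
  have h2 : ∀ l, ∃ k, (m k, v k) = (m' l, v' l) := by
    intro l
    apply gmW_exists π
    rw [key _ (hS' l), gmW_self π' m' v' hdist']
    exact_mod_cast (hπ'pos l).ne'
  choose τ hτ using h1
  have hbij : Function.Bijective τ := by
    constructor
    · intro k l hkl
      apply hinj
      rw [← hτ k, ← hτ l, hkl]
    · intro l
      obtain ⟨k, hk⟩ := h2 l
      exact ⟨k, hinj' _ _ ((hτ k).trans hk)⟩
  refine ⟨Equiv.ofBijective τ hbij, fun k => ?_⟩
  simp only [Equiv.ofBijective_apply]
  have hk := hτ k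
  refine ⟨?_, (congrArg Prod.fst hk).symm, (congrArg Prod.snd hk).symm⟩
  have e := key _ (hS k)
  rw [gmW_self π m v hdist, ← hk, gmW_self π' m' v' hdist'] at e
  exact_mod_cast e
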